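/- Soundness of the combined game for ∀^l∃^{k−l} properties (Theorem 3): Assume init = {c_0} is a singleton; assume the lifted initial set {c ∈ C^k | c_i ∈ init for all 1 ≤ i ≤ k}, each lifted observation set Ξ_i = {c ∈ C^k | c_i ∈ ξ_i} (1 ≤ i ≤ k), and every edge label of the automaton A are expressible in the abstraction; and assume that for every trace t of the transition system and every existential index l+1 ≤ i ≤ k, ξ_i is a valid observation on t. If player SAFE has a winning positional strategy in the safety game G^∃, then for all traces t_1, …, t_l of the transition system such that ξ_i is a valid observation on t_i for each 1 ≤ i ≤ l, there exist traces t_{l+1}, …, t_k of the transition system such that the infinite word w over C^k defined by w(j) = (t_1|ξ_1(j), …, t_k|ξ_k(j)) is accepted by A. -/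

import Mathlib

/-- A trace of the transition system `(init, step)`. -/
def IsTrace {C : Type*} (init : Set C) (step : Set (C × C)) (t : ℕ → C) : Prop :=
  t 0 ∈ init ∧ ∀ i, (t i, t (i + 1)) ∈ step

/-- `ξ` is a valid observation on `t` if `t i ∈ ξ` for infinitely many `i`. -/
def ValidObs {S : Type*} (ξ : Set S) (t : ℕ → S) : Prop :=
  {i : ℕ | t i ∈ ξ}.Infinite

/-- The filtered trace `t|ξ`: its `i`-th value is `t j` where `j` is the `i`-th index
(in increasing order) with `t j ∈ ξ`. -/
noncomputable def filterTrace {S : Type*} (t : ℕ → S) (ξ : Set S) : ℕ → S :=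
  fun i => t (Nat.nth (fun j => t j ∈ ξ) i)

/-- The concretization of an abstract state `s ∈ 𝔹ⁿ` w.r.t. the predicates `p`:
all elements on which predicate `p i` holds iff `s i = true`. -/
def conc {D : Type*} {n : ℕ} (p : Fin n → Set D) (s : Fin n → Bool) : Set D :=
  {d | ∀ i, d ∈ p i ↔ s i = true}

/-- A set is expressible in the abstraction if membership only depends on the
truth values of the predicates `p`. -/
def Expressible {D : Type*} {n : ℕ} (p : Fin n → Set D) (Y : Set D) : Prop :=
  ∀ d d', (∀ i, d ∈ p i ↔ d' ∈ p i) → (d ∈ Y ↔ d' ∈ Y)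

/-- `c'` is an `M`-step from `c`: every copy in the scheduling `M` takes a `step`,
all other copies stay put. -/
def MStep {C : Type*} {k : ℕ} (step : Set (C × C)) (M : Set (Fin k)) (c c' : Fin k → C) : Prop :=
  ∀ i, (i ∈ M → (c i, c' i) ∈ step) ∧ (i ∉ M → c' i = c i)

/-- `s'` is an `M`-successor of `s` (written `s →_M s'`). -/
def MSucc {C : Type*} {k n : ℕ} (p : Fin n → Set (Fin k → C)) (step : Set (C × C))
    (M : Set (Fin k)) (s s' : Fin n → Bool) : Prop :=
  ∃ c ∈ conc p s, ∃ c', MStep step M c c' ∧ c' ∈ conc p s'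

/-- `R` is a valid restriction for the abstract state `s` and scheduling `M`
(copies `i` with `(i : ℕ) < l` are universal, the remaining copies are existential):
for every concrete state in `⟦s⟧` and every move of the scheduled universal copies,
the scheduled existential copies can move such that the resulting tuple lies in the
concretization of some abstract state in `R`. -/
def ValidRes {C : Type*} {k n : ℕ} (step : Set (C × C)) (p : Fin n → Set (Fin k → C))
    (l : ℕ) (s : Fin n → Bool) (M : Set (Fin k)) (R : Set (Fin n → Bool)) : Prop :=
  ∀ c ∈ conc p s, ∀ cu : Fin k → C,
    (∀ i : Fin k, (i : ℕ) < l → ((i ∈ M → (c i, cu i) ∈ step) ∧ (i ∉ M → cu i = c i))) →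
    ∃ c' : Fin k → C,
      (∀ i : Fin k, (i : ℕ) < l → c' i = cu i) ∧
      (∀ i : Fin k, l ≤ (i : ℕ) → ((i ∈ M → (c i, c' i) ∈ step) ∧ (i ∉ M → c' i = c i))) ∧
      ∃ s' ∈ R, c' ∈ conc p s'

/-- A deterministic symbolic safety automaton over the alphabet `σ`: a finite set of
states `Q` with initial state `q0`, a finite set of edges `(q, E, q')` whose labels `E`
are sets of letters, and bad states `Bad`, such that for every state `q` and letter `a`
there is exactly one edge from `q` whose label contains `a`. -/
structure DSA (σ : Type*) where
  Q : Type*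
  finQ : Finite Q
  q0 : Q
  edges : Set (Q × Set σ × Q)
  finEdges : edges.Finite
  Bad : Set Q
  det : ∀ (q : Q) (a : σ), ∃! e : Q × Set σ × Q, e ∈ edges ∧ e.1 = q ∧ a ∈ e.2.1

/-- `r` is the run of `A` on the infinite word `w`. -/
def IsRun {σ : Type*} (A : DSA σ) (w : ℕ → σ) (r : ℕ → A.Q) : Prop :=
  r 0 = A.q0 ∧ ∀ j, ∃ E, (r j, E, r (j + 1)) ∈ A.edges ∧ w j ∈ E

/-- `w` is accepted by `A` if its run never visits a bad state. -/
def Accepted {σ : Type*} (A : DSA σ) (w : ℕ → σ) : Prop :=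
  ∀ r : ℕ → A.Q, IsRun A w r → ∀ j, r j ∉ A.Bad

/-- `obsAt p ξ s i` holds iff copy `i` is at an observation point in the abstract
state `s`, i.e. `⟦s⟧` intersects the lifted observation set `Ξ_i = {c | c i ∈ ξ i}`. -/
def obsAt {C : Type*} {k n : ℕ} (p : Fin n → Set (Fin k → C)) (ξ : Fin k → Set C)
    (s : Fin n → Bool) (i : Fin k) : Prop :=
  (conc p s ∩ {c : Fin k → C | c i ∈ ξ i}).Nonempty

/-- `σ` is a winning positional strategy for player SAFE in the safety game with edge
relation `Edge`, initial states `Init`, bad states `Bad` and SAFE-owned states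
`IsSafeSt`: `σ` picks, at every SAFE-state, a transition successor, and no (prefix of a)
play starting in an initial state, following the edges, and taking the prescribed move
at every SAFE-state ever visits a bad state. -/
def GWinning {St : Type*} (Edge : St → St → Prop) (Init Bad IsSafeSt : St → Prop)
    (σ : St → St) : Prop :=
  (∀ st, IsSafeSt st → Edge st (σ st)) ∧
  ∀ (pl : ℕ → St) (m : ℕ), Init (pl 0) →
    (∀ i < m, Edge (pl i) (pl (i + 1)) ∧ (IsSafeSt (pl i) → pl (i + 1) = σ (pl i))) →
    ¬ Bad (pl m)

/-- Game states of the combined game `G^∃`: SAFE-states `(ŝ, q, b)` and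
REACH-states `(ŝ, q, b, M, R)` carrying a scheduling `M` and a restriction `R`. -/
inductive GSE (n k : ℕ) (Q : Type*) where
  | safe (s : Fin n → Bool) (q : Q) (b : Fin k → Bool)
  | reach (s : Fin n → Bool) (q : Q) (b : Fin k → Bool) (M : Set (Fin k)) (R : Set (Fin n → Bool))

/-- SAFE-owned states of `G^∃`. -/
def GIsSafeE {n k : ℕ} {Q : Type*} : GSE n k Q → Prop
  | .safe _ _ _ => True
  | .reach _ _ _ _ _ => False

/-- Initial states of `G^∃`: all `(ŝ, q₀, ⊤^k)` with `⟦ŝ⟧` intersecting the lifted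
initial set. -/
def GInitE {C : Type*} {n k : ℕ} (p : Fin n → Set (Fin k → C)) (init : Set C)
    (Aut : DSA (Fin k → C)) (st : GSE n k Aut.Q) : Prop :=
  ∃ s : Fin n → Bool, st = GSE.safe s Aut.q0 (fun _ => true) ∧
    (conc p s ∩ {c : Fin k → C | ∀ i, c i ∈ init}).Nonempty

/-- Bad states of `G^∃`: those whose automaton component is bad. -/
def GBadE {n k : ℕ} {Q : Type*} (B : Set Q) : GSE n k Q → Prop
  | .safe _ q _ => q ∈ B
  | .reach _ q _ _ _ => q ∈ B

/-- Transitions of the combined game `G^∃`: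
(1) SAFE picks a nonempty scheduling `M` (only containing copies that have not moved
since the last automaton step or are not at an observation point) together with a
*valid restriction* `R`;
(2) if all copies are at observation points and all have moved, the automaton takes a
step (along the unique edge whose label intersects `⟦ŝ⟧`) and the move-marker is reset;
(3) REACH picks any abstract state in the restriction `R`, marking the scheduled
copies as moved. -/
inductive GEdgeE {C : Type*} {k n : ℕ} (p : Fin n → Set (Fin k → C)) (step : Set (C × C))
    (ξ : Fin k → Set C) (Aut : DSA (Fin k → C)) (l : ℕ) :
    GSE n k Aut.Q → GSE n k Aut.Q → Prop where
  | sched {s : Fin n → Bool} {q : Aut.Q} {b : Fin k → Bool} {M : Set (Fin k)}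
      {R : Set (Fin n → Bool)} :
      M.Nonempty →
      (∀ i ∈ M, b i = false ∨ ¬ obsAt p ξ s i) →
      ValidRes step p l s M R →
      GEdgeE p step ξ Aut l (.safe s q b) (.reach s q b M R)
  | auto {s : Fin n → Bool} {q q' : Aut.Q} {E : Set (Fin k → C)} :
      (∀ i, obsAt p ξ s i) →
      (q, E, q') ∈ Aut.edges →
      (conc p s ∩ E).Nonempty →
      GEdgeE p step ξ Aut l (.safe s q (fun _ => true)) (.safe s q' (fun _ => false))
  | move {s s' : Fin n → Bool} {q : Aut.Q} {b b' : Fin k → Bool} {M : Set (Fin k)}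
      {R : Set (Fin n → Bool)} :
      s' ∈ R →
      (∀ i ∈ M, b' i = true) →
      (∀ i ∉ M, b' i = b i) →
      GEdgeE p step ξ Aut l (.reach s q b M R) (.safe s' q b')

/-- The abstract state describing a concrete element. -/
noncomputable def absOf {D : Type*} {n : ℕ} (p : Fin n → Set D) (d : D) : Fin n → Bool :=
  open Classical in fun i => decide (d ∈ p i)

theorem mem_conc_absOf {D : Type*} {n : ℕ} (p : Fin n → Set D) (d : D) :
    d ∈ conc p (absOf p d) := by
  intro i
  simp [absOf]

theorem absOf_eq_of_mem_conc {D : Type*} {n : ℕ} {p : Fin n → Set D} {d : D}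
    {s : Fin n → Bool} (h : d ∈ conc p s) : absOf p d = s := by
  funext i
  have := h i
  simp [absOf, this]

theorem Expressible.mem_of_conc_inter {D : Type*} {n : ℕ} {p : Fin n → Set D} {Y : Set D}
    (hY : Expressible p Y) {d : D} (h : (conc p (absOf p d) ∩ Y).Nonempty) : d ∈ Y := by
  obtain ⟨e, he, heY⟩ := h
  exact (hY d e fun i => (mem_conc_absOf p d i).trans (he i).symm).2 heY

/-- A game state that is visited by some play compatible with `σ`. -/
def GReachable {St : Type*} (Edge : St → St → Prop) (Init IsSafeSt : St → Prop)
    (σ : St → St) (st : St) : Prop :=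
  ∃ (pl : ℕ → St) (m : ℕ), Init (pl 0) ∧
    (∀ i < m, Edge (pl i) (pl (i + 1)) ∧ (IsSafeSt (pl i) → pl (i + 1) = σ (pl i))) ∧ pl m = st

theorem GReachable.of_init {St : Type*} {Edge : St → St → Prop} {Init IsSafeSt : St → Prop}
    {σ : St → St} {st : St} (h : Init st) : GReachable Edge Init IsSafeSt σ st :=
  ⟨fun _ => st, 0, h, by simp, rfl⟩

theorem GReachable.tail {St : Type*} {Edge : St → St → Prop} {Init IsSafeSt : St → Prop}
    {σ : St → St} {st st' : St} (h : GReachable Edge Init IsSafeSt σ st) (he : Edge st st')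
    (hs : IsSafeSt st → st' = σ st) : GReachable Edge Init IsSafeSt σ st' := by
  obtain ⟨pl, m, h0, hpl, rfl⟩ := h
  refine ⟨fun i => if i ≤ m then pl i else st', m + 1, by simpa using h0, ?_, by simp⟩
  intro i hi
  rcases Nat.lt_succ_iff_lt_or_eq.1 hi with h | rfl
  · simpa [h.le, Nat.succ_le_of_lt h] using hpl i h
  · simpa using ⟨he, hs⟩

theorem GWinning.not_bad {St : Type*} {Edge : St → St → Prop} {Init Bad IsSafeSt : St → Prop}
    {σ : St → St} (hw : GWinning Edge Init Bad IsSafeSt σ) {st : St}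
    (h : GReachable Edge Init IsSafeSt σ st) : ¬ Bad st := by
  obtain ⟨pl, m, h0, hpl, rfl⟩ := h
  exact hw.2 pl m h0 hpl

/-- A concrete configuration of a play: the current tuple `c`, the number of moves `pos i`
of each copy, the automaton state `q`, the move-markers `b`, and the number `N` of
automaton steps taken. -/
structure PlayConfig (C : Type*) (k : ℕ) (Q : Type*) where
  c : Fin k → C
  pos : Fin k → ℕ
  q : Q
  b : Fin k → Bool
  N : ℕ

/-- An automaton step between configurations. -/
structure AutoStep {C : Type*} {k : ℕ} (ξ : Fin k → Set C) (Aut : DSA (Fin k → C))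
    (x y : PlayConfig C k Aut.Q) : Prop where
  marked : ∀ i, x.b i = true
  obs : ∀ i, x.c i ∈ ξ i
  edge : ∃ E, (x.q, E, y.q) ∈ Aut.edges ∧ x.c ∈ E
  c_eq : y.c = x.c
  pos_eq : y.pos = x.pos
  unmarked : ∀ i, y.b i = false
  N_eq : y.N = x.N + 1

/-- A step between configurations moving the copies of a nonempty scheduling. -/
structure SchedStep {C : Type*} {k : ℕ} (step : Set (C × C)) (ξ : Fin k → Set C) {Q : Type*}
    (M : Set (Fin k)) (x y : PlayConfig C k Q) : Prop where
  nonempty : M.Nonempty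
  allowed : ∀ i ∈ M, x.b i = false ∨ x.c i ∉ ξ i
  moved : ∀ i ∈ M, (x.c i, y.c i) ∈ step ∧ y.pos i = x.pos i + 1 ∧ y.b i = true
  stay : ∀ i ∉ M, y.c i = x.c i ∧ y.pos i = x.pos i ∧ y.b i = x.b i
  q_eq : y.q = x.q
  N_eq : y.N = x.N

/-- One step of a concrete play. -/
def PlayStep {C : Type*} {k : ℕ} (step : Set (C × C)) (ξ : Fin k → Set C)
    (Aut : DSA (Fin k → C)) (x y : PlayConfig C k Aut.Q) : Prop :=
  AutoStep ξ Aut x y ∨ ∃ M, SchedStep step ξ M x y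

section Play

variable {C : Type*} {k : ℕ} {step : Set (C × C)} {ξ : Fin k → Set C} {Aut : DSA (Fin k → C)}

theorem PlayStep.copy {x y : PlayConfig C k Aut.Q} (h : PlayStep step ξ Aut x y) (i : Fin k) :
    (y.c i = x.c i ∧ y.pos i = x.pos i) ∨
      ((x.c i, y.c i) ∈ step ∧ y.pos i = x.pos i + 1) := by
  rcases h with h | ⟨M, h⟩
  · exact Or.inl ⟨congrFun h.c_eq i, congrFun h.pos_eq i⟩
  · by_cases hi : i ∈ M
    · exact Or.inr ⟨(h.moved i hi).1, (h.moved i hi).2.1⟩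
    · exact Or.inl ⟨(h.stay i hi).1, (h.stay i hi).2.1⟩

theorem PlayStep.pos_le {x y : PlayConfig C k Aut.Q} (h : PlayStep step ξ Aut x y)
    (i : Fin k) : x.pos i ≤ y.pos i := by
  rcases h.copy i with h | h <;> omega

theorem PlayStep.measure_lt {x y : PlayConfig C k Aut.Q} (h : PlayStep step ξ Aut x y) :
    x.N + ∑ i, x.pos i < y.N + ∑ i, y.pos i := by
  have hpos := h.pos_le
  have hle : ∑ i, x.pos i ≤ ∑ i, y.pos i := Finset.sum_le_sum fun i _ => hpos i
  rcases h with h' | ⟨M, h'⟩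
  · have := h'.N_eq
    omega
  · obtain ⟨i, hi⟩ := h'.nonempty
    have : ∑ i, x.pos i < ∑ i, y.pos i :=
      Finset.sum_lt_sum (fun i _ => hpos i)
        ⟨i, Finset.mem_univ i, by have := (h'.moved i hi).2.1; omega⟩
    have := h'.N_eq
    omega

variable {x : ℕ → PlayConfig C k Aut.Q}

theorem pos_monotone (hx : ∀ τ, PlayStep step ξ Aut (x τ) (x (τ + 1))) (i : Fin k) :
    Monotone fun τ => (x τ).pos i :=
  monotone_nat_of_le_succ fun τ => (hx τ).pos_le i

/-- The state of a copy only depends on the number of its moves. -/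
theorem c_eq_of_pos_eq (hx : ∀ τ, PlayStep step ξ Aut (x τ) (x (τ + 1))) (i : Fin k)
    {τ τ' : ℕ} (h : (x τ).pos i = (x τ').pos i) : (x τ).c i = (x τ').c i := by
  wlog hle : τ ≤ τ' generalizing τ τ'
  · exact (this h.symm (Nat.le_of_not_le hle)).symm
  induction τ', hle using Nat.le_induction with
  | base => rfl
  | succ m hm ih =>
    have h1 : (x τ).pos i ≤ (x m).pos i := pos_monotone hx i hm
    rcases (hx m).copy i with h2 | h2
    · rw [h2.1]
      exact ih (h.trans h2.2)
    · omega

/-- A sequence of naturals starting at `0`, growing by at most one, and reaching beyond `m`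
passes from `m` to `m + 1`. -/
theorem exists_crossing {f : ℕ → ℕ} (h0 : f 0 = 0) (hf : ∀ τ, f (τ + 1) ≤ f τ + 1) {m τ : ℕ}
    (h : m < f τ) : ∃ τ', f τ' = m ∧ f (τ' + 1) = m + 1 := by
  induction τ with
  | zero => omega
  | succ τ ih =>
    by_cases hlt : m < f τ
    · exact ih hlt
    · exact ⟨τ, by have := hf τ; omega, by have := hf τ; omega⟩

theorem exists_move (hx : ∀ τ, PlayStep step ξ Aut (x τ) (x (τ + 1))) {i : Fin k}
    (h0 : (x 0).pos i = 0) {m τ : ℕ} (h : m < (x τ).pos i) :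
    ∃ τ', (x τ').pos i = m ∧ (x (τ' + 1)).pos i = m + 1 ∧
      ((x τ').c i, (x (τ' + 1)).c i) ∈ step := by
  obtain ⟨τ', h1, h2⟩ := exists_crossing (f := fun τ => (x τ).pos i) h0
    (fun τ => by rcases (hx τ).copy i with h | h <;> omega) h
  refine ⟨τ', h1, h2, ?_⟩
  rcases (hx τ').copy i with h | h
  · omega
  · exact h.1

/-- The sequence of states passed by a copy during a play, a trace if the copy moves
infinitely often. -/
theorem exists_copy_trace (hx : ∀ τ, PlayStep step ξ Aut (x τ) (x (τ + 1))) {i : Fin k}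
    (h0 : (x 0).pos i = 0) {init : Set C} (hinit : (x 0).c i ∈ init) :
    ∃ u : ℕ → C, (∀ τ, (x τ).c i = u ((x τ).pos i)) ∧
      ((∀ m, ∃ τ, m < (x τ).pos i) → IsTrace init step u) := by
  classical
  let u : ℕ → C := fun m =>
    if h : ∃ τ, (x τ).pos i = m then (x h.choose).c i else (x 0).c i
  have hu : ∀ τ, (x τ).c i = u ((x τ).pos i) := fun τ => by
    have h : ∃ τ', (x τ').pos i = (x τ).pos i := ⟨τ, rfl⟩
    simp only [u, dif_pos h]
    exact c_eq_of_pos_eq hx i h.choose_spec.symm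
  refine ⟨u, hu, fun hm => ⟨?_, fun m => ?_⟩⟩
  · rw [← h0, ← hu]
    exact hinit
  · obtain ⟨τ, hτ⟩ := hm m
    obtain ⟨τ', h1, h2, h3⟩ := exists_move hx h0 hτ
    rwa [hu, hu, h1, h2] at h3

open Classical in
/-- A marked copy has passed exactly as many observation points as there were automaton
steps, and an unmarked copy rests at the last observation point. -/
theorem count_obs (hx : ∀ τ, PlayStep step ξ Aut (x τ) (x (τ + 1))) {i : Fin k}
    (h0 : (x 0).pos i = 0) (hN : (x 0).N = 0) (hb : (x 0).b i = true) {u : ℕ → C}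
    (hu : ∀ τ, (x τ).c i = u ((x τ).pos i)) (τ : ℕ) :
    ((x τ).b i = true → Nat.count (fun j => u j ∈ ξ i) ((x τ).pos i) = (x τ).N) ∧
    ((x τ).b i = false →
      Nat.count (fun j => u j ∈ ξ i) ((x τ).pos i) + 1 = (x τ).N ∧ (x τ).c i ∈ ξ i) := by
  induction τ with
  | zero => simp [h0, hN, hb]
  | succ τ ih =>
    rcases hx τ with h | ⟨M, h⟩
    · refine ⟨fun h' => by simp [h.unmarked i] at h', fun _ => ⟨?_, ?_⟩⟩
      · rw [h.pos_eq, h.N_eq, ih.1 (h.marked i)]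
      · rw [h.c_eq]
        exact h.obs i
    · by_cases hi : i ∈ M
      · obtain ⟨-, hp, hb'⟩ := h.moved i hi
        refine ⟨fun _ => ?_, fun h' => by simp [hb'] at h'⟩
        rw [hp, h.N_eq, Nat.count_succ, ← hu]
        cases hbi : (x τ).b i with
        | false => simpa [(ih.2 hbi).2] using (ih.2 hbi).1
        | true =>
          have : (x τ).c i ∉ ξ i := by simpa [hbi] using h.allowed i hi
          simpa [this] using ih.1 hbi
      · obtain ⟨hc, hp, hb'⟩ := h.stay i hi
        rwa [hc, hp, hb', h.N_eq]

/-- If every copy that moves infinitely often has infinitely many observation points, then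
the automaton takes infinitely many steps. -/
theorem N_unbounded (hx : ∀ τ, PlayStep step ξ Aut (x τ) (x (τ + 1)))
    (h0 : ∀ i, (x 0).pos i = 0) (hN : (x 0).N = 0) (hb : ∀ i, (x 0).b i = true)
    {u : Fin k → ℕ → C} (hu : ∀ i τ, (x τ).c i = u i ((x τ).pos i))
    (hv : ∀ i, (∀ m, ∃ τ, m < (x τ).pos i) → ValidObs (ξ i) (u i)) (m : ℕ) :
    ∃ τ, m < (x τ).N := by
  classical
  by_contra! hle
  have hbound : ∀ i, ∃ B, ∀ τ, (x τ).pos i ≤ B := by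
    intro i
    by_contra! hunb
    have hinf : {j | u i j ∈ ξ i}.Infinite := hv i hunb
    obtain ⟨τ, hτ⟩ := hunb (Nat.nth (fun j => u i j ∈ ξ i) (m + 1))
    have h1 := Nat.count_monotone (fun j => u i j ∈ ξ i) hτ.le
    rw [Nat.count_nth_of_infinite hinf] at h1
    have h2 := count_obs hx (h0 i) hN (hb i) (hu i) τ
    have h3 := hle τ
    cases hbi : (x τ).b i with
    | false =>
      have := (h2.2 hbi).1
      omega
    | true =>
      have := h2.1 hbi
      omega
  choose B hB using hbound
  have hgrow : ∀ τ, τ ≤ (x τ).N + ∑ i, (x τ).pos i := by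
    intro τ
    induction τ with
    | zero => simp
    | succ τ ih =>
      have := (hx τ).measure_lt
      omega
  have h1 := hgrow (m + ∑ i, B i + 1)
  have h2 := hle (m + ∑ i, B i + 1)
  have h3 : ∑ i, (x (m + ∑ i, B i + 1)).pos i ≤ ∑ i, B i :=
    Finset.sum_le_sum fun i _ => hB i _
  omega

theorem pos_unbounded (hx : ∀ τ, PlayStep step ξ Aut (x τ) (x (τ + 1))) {i : Fin k}
    (h0 : (x 0).pos i = 0) (hN : (x 0).N = 0) (hb : (x 0).b i = true) {u : ℕ → C}
    (hu : ∀ τ, (x τ).c i = u ((x τ).pos i)) (hunb : ∀ m, ∃ τ, m < (x τ).N) (m : ℕ) :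
    ∃ τ, m < (x τ).pos i := by
  classical
  obtain ⟨τ, hτ⟩ := hunb (m + 1)
  refine ⟨τ, ?_⟩
  have h2 := count_obs hx h0 hN hb hu τ
  have h3 : Nat.count (fun j => u j ∈ ξ i) ((x τ).pos i) ≤ (x τ).pos i := Nat.count_le _
  cases hbi : (x τ).b i with
  | false =>
    have := (h2.2 hbi).1
    omega
  | true =>
    have := h2.1 hbi
    omega

/-- A run on the word of filtered traces follows the automaton states of the play. -/
theorem q_eq_run (hx : ∀ τ, PlayStep step ξ Aut (x τ) (x (τ + 1)))
    (h0 : ∀ i, (x 0).pos i = 0) (hN : (x 0).N = 0) (hb : ∀ i, (x 0).b i = true)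
    (hq : (x 0).q = Aut.q0)
    {u : Fin k → ℕ → C} (hu : ∀ i τ, (x τ).c i = u i ((x τ).pos i))
    {r : ℕ → Aut.Q} (hr : IsRun Aut (fun j i => filterTrace (u i) (ξ i) j) r) (τ : ℕ) :
    (x τ).q = r (x τ).N := by
  classical
  induction τ with
  | zero => rw [hq, hN, hr.1]
  | succ τ ih =>
    rcases hx τ with h | ⟨M, h⟩
    · have hw : (fun i => filterTrace (u i) (ξ i) (x τ).N) = (x τ).c := by
        funext i
        have hc := (count_obs hx (h0 i) hN (hb i) (hu i) τ).1 (h.marked i)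
        have hmem : u i ((x τ).pos i) ∈ ξ i := by
          rw [← hu]
          exact h.obs i
        have hnth := Nat.nth_count (p := fun j => u i j ∈ ξ i) hmem
        rw [hu i τ, filterTrace, ← hc, hnth]
      obtain ⟨E, hE, hcE⟩ := h.edge
      obtain ⟨E', hE', hcE'⟩ := hr.2 (x τ).N
      simp only [hw] at hcE'
      rw [← ih] at hE'
      have := (Aut.det (x τ).q (x τ).c).unique ⟨hE, rfl, hcE⟩ ⟨hE', rfl, hcE'⟩
      rw [h.N_eq]
      exact congrArg (fun e => e.2.2) this
    · rw [h.q_eq, h.N_eq, ih]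

end Play

/-- The invariant of concrete plays following `σ`: the abstraction is reachable in the game,
and the universal copies follow the given traces. -/
def PlayInv {C : Type*} {k n : ℕ} (l : ℕ) (init : Set C) (step : Set (C × C))
    (p : Fin n → Set (Fin k → C)) (ξ : Fin k → Set C) (Aut : DSA (Fin k → C))
    (σ : GSE n k Aut.Q → GSE n k Aut.Q) (t : Fin k → ℕ → C) (x : PlayConfig C k Aut.Q) : Prop :=
  GReachable (GEdgeE p step ξ Aut l) (GInitE p init Aut) GIsSafeE σ
    (.safe (absOf p x.c) x.q x.b) ∧
  ∀ i : Fin k, (i : ℕ) < l → x.c i = t i (x.pos i)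

/-- A concrete play following a strategy can always be continued. -/
theorem PlayInv.exists_step {C : Type*} {k n : ℕ} {l : ℕ} {init : Set C} {step : Set (C × C)}
    {p : Fin n → Set (Fin k → C)} {ξ : Fin k → Set C} {Aut : DSA (Fin k → C)}
    {σ : GSE n k Aut.Q → GSE n k Aut.Q} {t : Fin k → ℕ → C}
    (hobs_expr : ∀ i : Fin k, Expressible p {c : Fin k → C | c i ∈ ξ i})
    (hlabels : ∀ e ∈ Aut.edges, Expressible p e.2.1)
    (hσ : ∀ st, GIsSafeE st → GEdgeE p step ξ Aut l st (σ st))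
    (ht : ∀ i : Fin k, (i : ℕ) < l → IsTrace init step (t i))
    {x : PlayConfig C k Aut.Q} (hx : PlayInv l init step p ξ Aut σ t x) :
    ∃ y, PlayInv l init step p ξ Aut σ t y ∧ PlayStep step ξ Aut x y := by
  classical
  obtain ⟨c, pos, q, b, N⟩ := x
  obtain ⟨hreach, hpos⟩ := hx
  simp only at hreach hpos
  have hedge := hσ (.safe (absOf p c) q b) trivial
  generalize hst : σ (.safe (absOf p c) q b) = st at hedge
  have hreach' := hreach.tail hedge fun _ => hst.symm
  cases hedge with
  | @sched _ _ _ M R hM hallowed hvalid =>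
    obtain ⟨c', hcu, hce, s', hs', hcs'⟩ := hvalid c (mem_conc_absOf p c)
      (fun i => if i ∈ M then t i (pos i + 1) else c i) (by
        intro i hi
        refine ⟨fun hiM => ?_, fun hiM => by simp [hiM]⟩
        simpa [hiM, hpos i hi] using (ht i hi).2 (pos i))
    have hstep : ∀ i, (i ∈ M → (c i, c' i) ∈ step) ∧ (i ∉ M → c' i = c i) := by
      intro i
      rcases lt_or_ge (i : ℕ) l with hi | hi
      · rw [hcu i hi]
        refine ⟨fun hiM => ?_, fun hiM => by simp [hiM]⟩
        simpa [hiM, hpos i hi] using (ht i hi).2 (pos i)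
      · exact hce i hi
    refine ⟨⟨c', fun i => if i ∈ M then pos i + 1 else pos i, q,
      fun i => if i ∈ M then true else b i, N⟩, ⟨?_, ?_⟩, Or.inr ⟨M, hM, ?_, ?_, ?_, rfl, rfl⟩⟩
    · refine hreach'.tail (.move ?_ ?_ ?_) fun h => h.elim
      · rwa [absOf_eq_of_mem_conc hcs']
      · intro i hi
        simp [hi]
      · intro i hi
        simp [hi]
    · intro i hi
      by_cases hiM : i ∈ M
      · simp [hcu i hi, hiM]
      · simp [hcu i hi, hiM, hpos i hi]
    · exact fun i hi => (hallowed i hi).imp_right fun h hc =>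
        h ⟨c, mem_conc_absOf p c, hc⟩
    · intro i hi
      simpa [hi] using (hstep i).1 hi
    · intro i hi
      simpa [hi] using (hstep i).2 hi
  | @auto _ _ q' E hobs hE hne =>
    exact ⟨⟨c, pos, q', fun _ => false, N + 1⟩, ⟨hreach', hpos⟩, Or.inl
      ⟨fun _ => rfl, fun i => (hobs_expr i).mem_of_conc_inter (hobs i),
        ⟨E, hE, (hlabels _ hE).mem_of_conc_inter hne⟩, rfl, rfl, fun _ => rfl, rfl⟩⟩

/-- Theorem 3: soundness of the combined game for `∀^l∃^(k-l)`
properties. Assume `init = {c0}` is a singleton, the lifted initial set, the lifted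
observation sets and all automaton edge labels are expressible in the abstraction, and
every existential observation set is valid on every trace of the system. If player
SAFE has a winning positional strategy in `G^∃`, then for all traces assigned to the
universally quantified copies (`i < l`, with valid observations), there exist traces
for the existentially quantified copies such that the zipped word of filtered traces
is accepted by the automaton. -/
theorem combined_game_soundness {C : Type*} {k n : ℕ} (hk : 1 ≤ k)
    (l : ℕ) (hl : l ≤ k)
    (init : Set C) (step : Set (C × C)) (c0 : C) (hsingleton : init = {c0})
    (p : Fin n → Set (Fin k → C)) (ξ : Fin k → Set C)
    (Aut : DSA (Fin k → C))
    (hinit_expr : Expressible p {c : Fin k → C | ∀ i, c i ∈ init})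
    (hobs_expr : ∀ i : Fin k, Expressible p {c : Fin k → C | c i ∈ ξ i})
    (hlabels : ∀ e ∈ Aut.edges, Expressible p e.2.1)
    (hexist_obs : ∀ t : ℕ → C, IsTrace init step t →
      ∀ i : Fin k, l ≤ (i : ℕ) → ValidObs (ξ i) t)
    (σ : GSE n k Aut.Q → GSE n k Aut.Q)
    (hwin : GWinning (GEdgeE p step ξ Aut l) (GInitE p init Aut) (GBadE Aut.Bad)
      GIsSafeE σ)
    (t : Fin k → ℕ → C)
    (ht : ∀ i : Fin k, (i : ℕ) < l → IsTrace init step (t i))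
    (hv : ∀ i : Fin k, (i : ℕ) < l → ValidObs (ξ i) (t i)) :
    ∃ t' : Fin k → ℕ → C,
      (∀ i : Fin k, (i : ℕ) < l → t' i = t i) ∧
      (∀ i : Fin k, IsTrace init step (t' i)) ∧
      Accepted Aut (fun j => fun i => filterTrace (t' i) (ξ i) j) := by
  have hσ := hwin.1
  subst hsingleton
  let x0 : PlayConfig C k Aut.Q := ⟨fun _ => c0, fun _ => 0, Aut.q0, fun _ => true, 0⟩
  have hx0 : PlayInv l {c0} step p ξ Aut σ t x0 :=
    ⟨.of_init ⟨_, rfl, fun _ => c0, mem_conc_absOf p _, fun _ => rfl⟩,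
      fun i hi => ((ht i hi).1).symm⟩
  choose! next hnext using fun (x : PlayConfig C k Aut.Q)
    (hx : PlayInv l {c0} step p ξ Aut σ t x) => hx.exists_step hobs_expr hlabels hσ ht
  let x : ℕ → PlayConfig C k Aut.Q := fun τ => next^[τ] x0
  have hxsucc : ∀ τ, x (τ + 1) = next (x τ) := fun τ => Function.iterate_succ_apply' next τ x0
  have hinv : ∀ τ, PlayInv l {c0} step p ξ Aut σ t (x τ) := by
    intro τ
    induction τ with
    | zero => exact hx0
    | succ τ ih =>
      rw [hxsucc]
      exact (hnext _ ih).1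
  have hx : ∀ τ, PlayStep step ξ Aut (x τ) (x (τ + 1)) := fun τ => by
    rw [hxsucc]
    exact (hnext _ (hinv τ)).2
  have htraces : ∀ i : Fin k, ∃ u : ℕ → C, ((i : ℕ) < l → u = t i) ∧
      (∀ τ, (x τ).c i = u ((x τ).pos i)) ∧
      ((∀ m, ∃ τ, m < (x τ).pos i) → IsTrace {c0} step u) := by
    intro i
    by_cases hi : (i : ℕ) < l
    · exact ⟨t i, fun _ => rfl, fun τ => (hinv τ).2 i hi, fun _ => ht i hi⟩
    · obtain ⟨u, hu⟩ := exists_copy_trace hx (i := i) rfl (init := {c0}) rfl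
      exact ⟨u, fun h => absurd h hi, hu⟩
  choose u hut hu htr using htraces
  have hN : ∀ m, ∃ τ, m < (x τ).N :=
    N_unbounded hx (fun _ => rfl) rfl (fun _ => rfl) hu fun i hm => by
      by_cases hi : (i : ℕ) < l
      · rw [hut i hi]
        exact hv i hi
      · exact hexist_obs _ (htr i hm) i (Nat.le_of_not_lt hi)
  refine ⟨u, hut, fun i => htr i (pos_unbounded hx rfl rfl rfl (hu i) hN), ?_⟩
  intro r hr j
  obtain ⟨τ, hτ⟩ := hN j
  obtain ⟨τ', hj, -⟩ := exists_crossing (f := fun τ => (x τ).N) rfl (fun τ => by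
    rcases hx τ with h | ⟨M, h⟩
    · exact h.N_eq.le
    · exact h.N_eq.le.trans (Nat.le_succ _)) hτ
  rw [← hj, ← q_eq_run hx (fun _ => rfl) rfl (fun _ => rfl) rfl hu hr τ']
  exact hwin.not_bad (hinv τ').1
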